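/- Let v : ℝ³ → ℝ³ be twice continuously differentiable with v, Dv, D²v bounded and tending to 0 at infinity (v ∈ C₀²(ℝ³,ℝ³)), and let φ, ψ be C¹ diffeomorphisms of ℝ³ with φ − id, ψ − id ∈ C₀¹(ℝ³,ℝ³). Then ‖v ∘ φ − v ∘ ψ‖_{1,∞} ≤ (2 + ‖ψ − id‖_{1,∞}) ‖v‖_{2,∞} ‖φ − ψ‖_{1,∞}. -/

import Mathlib

open MeasureTheory Filter Set
open scoped Topology

noncomputable section

/-- Euclidean 3-space. -/
abbrev E3 : Type := EuclideanSpace ℝ (Fin 3)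

/-- The supremum over `ℝ³` of the norm of the `k`-th derivative of `v`. -/
def supDeriv (k : ℕ) (v : E3 → E3) : ℝ := ⨆ x : E3, ‖iteratedFDeriv ℝ k v x‖

/-- The norm `‖v‖_{s,∞} = Σ_{k ≤ s} sup_x |Dᵏ v(x)|`. -/
def normS (s : ℕ) (v : E3 → E3) : ℝ := ∑ k ∈ Finset.range (s + 1), supDeriv k v

/-- Membership in `C₀^s(ℝ³,ℝ³)`: `v` is `C^s` and all derivatives up to order `s`
tend to `0` at infinity. -/
def MemC0 (s : ℕ) (v : E3 → E3) : Prop :=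
  ContDiff ℝ s v ∧
    ∀ k ≤ s, Tendsto (fun x => ‖iteratedFDeriv ℝ k v x‖) (cocompact E3) (𝓝 0)

/-- `Diff_id^s(ℝ³)`: `C^s`-diffeomorphisms of `ℝ³` equal to the identity at infinity. -/
structure DiffId (s : ℕ) : Type where
  toFun : E3 → E3
  invFun : E3 → E3
  left_inv : Function.LeftInverse invFun toFun
  right_inv : Function.RightInverse invFun toFun
  memC0 : MemC0 s fun x => toFun x - x
  memC0_inv : MemC0 s fun x => invFun x - x

instance (s : ℕ) : CoeFun (DiffId s) fun _ => E3 → E3 := ⟨DiffId.toFun⟩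



lemma MemC0.bdd {s : ℕ} {v : E3 → E3} (h : MemC0 s v) {k : ℕ} (hk : k ≤ s) :
    BddAbove (Set.range fun x => ‖iteratedFDeriv ℝ k v x‖) := by
  have hc : Continuous (fun x => ‖iteratedFDeriv ℝ k v x‖) :=
    (h.1.continuous_iteratedFDeriv (by exact_mod_cast hk)).norm
  obtain ⟨C, hC⟩ := (ZeroAtInftyContinuousMap.mk ⟨_, hc⟩ (h.2 k hk)).toBCF.bddAbove_range_norm_comp
  refine ⟨C, ?_⟩
  rintro _ ⟨x, rfl⟩
  have := hC ⟨x, rfl⟩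
  exact (le_abs_self _).trans this

lemma le_supDeriv {s : ℕ} {v : E3 → E3} (h : MemC0 s v) {k : ℕ} (hk : k ≤ s) (x : E3) :
    ‖iteratedFDeriv ℝ k v x‖ ≤ supDeriv k v := le_ciSup (h.bdd hk) x

lemma supDeriv_nonneg (k : ℕ) (v : E3 → E3) : 0 ≤ supDeriv k v :=
  Real.iSup_nonneg fun _ => norm_nonneg _

lemma MemC0.sub {s : ℕ} {v w : E3 → E3} (hv : MemC0 s v) (hw : MemC0 s w) :
    MemC0 s (fun x => v x - w x) := by
  refine ⟨hv.1.sub hw.1, fun k hk => ?_⟩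
  have h := (hv.2 k hk).add (hw.2 k hk)
  rw [add_zero] at h
  refine squeeze_zero (fun _ => norm_nonneg _) (fun x => ?_) h
  have hk' : (k : WithTop ℕ∞) ≤ s := by exact_mod_cast hk
  have e : iteratedFDeriv ℝ k (fun x => v x - w x) x
      = iteratedFDeriv ℝ k v x - iteratedFDeriv ℝ k w x :=
    iteratedFDeriv_sub_apply (hv.1.of_le hk').contDiffAt (hw.1.of_le hk').contDiffAt
  rw [e]
  exact norm_sub_le _ _

/-- **Lemma 7.2(ii)**: for `v ∈ C₀²(ℝ³,ℝ³)` and `φ, ψ ∈ Diff_id^1(ℝ³)`, one has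
`‖v ∘ φ − v ∘ ψ‖_{1,∞} ≤ (2 + ‖ψ − id‖_{1,∞}) ‖v‖_{2,∞} ‖φ − ψ‖_{1,∞}`. -/
theorem composition_difference_estimate (v : E3 → E3) (hv : MemC0 2 v) (φ ψ : DiffId 1) :
    normS 1 (fun x => v (φ x) - v (ψ x)) ≤
      (2 + normS 1 fun x => ψ x - x) * normS 2 v * normS 1 fun x => φ x - ψ x := by
  have hφψ : MemC0 1 (fun x => φ x - ψ x) := by
    simpa using φ.memC0.sub ψ.memC0
  have dψ' : Differentiable ℝ (fun x => ψ x - x) := ψ.memC0.1.differentiable (by simp)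
  have dφ' : Differentiable ℝ (fun x => φ x - x) := φ.memC0.1.differentiable (by simp)
  have dψ : Differentiable ℝ ψ.toFun := by
    simpa using dψ'.add differentiable_id
  have dφ : Differentiable ℝ φ.toFun := by
    simpa using dφ'.add differentiable_id
  have dv : Differentiable ℝ v := hv.1.differentiable (by simp)
  have ddv : Differentiable ℝ (fderiv ℝ v) :=
    (hv.1.fderiv_right (m := 1) (by norm_num)).differentiable (by simp)
  have b1 : ∀ x, ‖fderiv ℝ v x‖ ≤ supDeriv 1 v := fun x => by
    rw [← norm_iteratedFDeriv_one]; exact le_supDeriv hv (by norm_num) x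
  have b2 : ∀ x, ‖fderiv ℝ (fderiv ℝ v) x‖ ≤ supDeriv 2 v := fun x => by
    rw [← norm_iteratedFDeriv_one, norm_iteratedFDeriv_fderiv]
    exact le_supDeriv hv (by norm_num) x
  have d0 : ∀ x, ‖φ x - ψ x‖ ≤ supDeriv 0 (fun x => φ x - ψ x) := fun x => by
    have := le_supDeriv hφψ (Nat.zero_le 1) x
    rwa [norm_iteratedFDeriv_zero] at this
  have d1 : ∀ x, ‖fderiv ℝ φ.toFun x - fderiv ℝ ψ.toFun x‖
      ≤ supDeriv 1 (fun x => φ x - ψ x) := fun x => by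
    have := le_supDeriv hφψ le_rfl x
    rwa [norm_iteratedFDeriv_one, fderiv_fun_sub (dφ x) (dψ x)] at this
  have p1 : ∀ x, ‖fderiv ℝ ψ.toFun x‖ ≤ 1 + supDeriv 1 (fun x => ψ x - x) := fun x => by
    have := le_supDeriv ψ.memC0 le_rfl x
    rw [norm_iteratedFDeriv_one, fderiv_fun_sub (dψ x) differentiableAt_fun_id, fderiv_fun_id] at this
    have h1 : ‖ContinuousLinearMap.id ℝ E3‖ ≤ 1 := ContinuousLinearMap.norm_id_le
    have h2 := norm_le_norm_add_norm_sub' (fderiv ℝ ψ.toFun x) (ContinuousLinearMap.id ℝ E3)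
    linarith
  have n0 := supDeriv_nonneg 0 v
  have n1 := supDeriv_nonneg 1 v
  have n2 := supDeriv_nonneg 2 v
  have m0 := supDeriv_nonneg 0 (fun x => φ x - ψ x)
  have m1 := supDeriv_nonneg 1 (fun x => φ x - ψ x)
  have q0 := supDeriv_nonneg 0 (fun x => ψ x - x)
  have q1 := supDeriv_nonneg 1 (fun x => ψ x - x)
  have A : supDeriv 0 (fun x => v (φ x) - v (ψ x))
      ≤ supDeriv 1 v * supDeriv 0 (fun x => φ x - ψ x) := by
    refine ciSup_le fun x => ?_
    rw [norm_iteratedFDeriv_zero]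
    refine (convex_univ.norm_image_sub_le_of_norm_fderiv_le (fun y _ => dv y)
      (fun y _ => b1 y) (mem_univ (ψ x)) (mem_univ (φ x))).trans ?_
    exact mul_le_mul_of_nonneg_left (d0 x) n1
  have B : supDeriv 1 (fun x => v (φ x) - v (ψ x))
      ≤ supDeriv 1 v * supDeriv 1 (fun x => φ x - ψ x)
        + supDeriv 2 v * supDeriv 0 (fun x => φ x - ψ x)
          * (1 + supDeriv 1 (fun x => ψ x - x)) := by
    refine ciSup_le fun x => ?_
    have e : fderiv ℝ (fun x => v (φ x) - v (ψ x)) x =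
        (fderiv ℝ v (φ x)).comp (fderiv ℝ φ.toFun x - fderiv ℝ ψ.toFun x)
        + (fderiv ℝ v (φ x) - fderiv ℝ v (ψ x)).comp (fderiv ℝ ψ.toFun x) := by
      have h := ((dv (φ x)).hasFDerivAt.comp x (dφ x).hasFDerivAt).sub
        ((dv (ψ x)).hasFDerivAt.comp x (dψ x).hasFDerivAt)
      refine HasFDerivAt.fderiv (f := fun x => v (φ x) - v (ψ x)) h |>.trans ?_
      ext1 y
      simp
    rw [norm_iteratedFDeriv_one, e]
    have h2 : ‖fderiv ℝ v (φ x) - fderiv ℝ v (ψ x)‖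
        ≤ supDeriv 2 v * supDeriv 0 (fun x => φ x - ψ x) := by
      refine (convex_univ.norm_image_sub_le_of_norm_fderiv_le (fun y _ => ddv y)
        (fun y _ => b2 y) (mem_univ (ψ x)) (mem_univ (φ x))).trans ?_
      exact mul_le_mul_of_nonneg_left (d0 x) n2
    refine (norm_add_le _ _).trans (add_le_add ?_ ?_)
    · exact (ContinuousLinearMap.opNorm_comp_le _ _).trans
        (mul_le_mul (b1 _) (d1 x) (norm_nonneg _) n1)
    · exact (ContinuousLinearMap.opNorm_comp_le _ _).trans
        (mul_le_mul h2 (p1 x) (norm_nonneg _) (mul_nonneg n2 m0))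
  simp only [normS, Finset.sum_range_succ, Finset.sum_range_zero, zero_add]
  refine (add_le_add A B).trans ?_
  generalize supDeriv 0 v = V0 at *
  generalize supDeriv 1 v = V1 at *
  generalize supDeriv 2 v = V2 at *
  generalize supDeriv 0 (fun x => φ x - ψ x) = D0 at *
  generalize supDeriv 1 (fun x => φ x - ψ x) = D1 at *
  generalize supDeriv 0 (fun x => ψ x - x) = P0 at *
  generalize supDeriv 1 (fun x => ψ x - x) = P1 at *
  have : 0 ≤ (2 + (P0 + P1)) * (V0 + V1 + V2) * (D0 + D1)
      - (V1 * D0 + (V1 * D1 + V2 * D0 * (1 + P1))) := by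
    have e : (2 + (P0 + P1)) * (V0 + V1 + V2) * (D0 + D1)
      - (V1 * D0 + (V1 * D1 + V2 * D0 * (1 + P1)))
      = (V0 + V2) * (D0 + D1) + (1 + P1) * ((V0 + V1) * (D0 + D1) + V2 * D1)
        + P0 * (V0 + V1 + V2) * (D0 + D1) := by ring
    rw [e]; positivity
  linarith

end
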